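/- arXiv:2008.07895 — 4 statements merged into one kernel-verified Lean document; each statement's English description precedes it below -/
import Mathlib

section
/- Every free lattice polygon in the plane has at most 4 vertices: if S ⊆ ℤ² is a finite set of points such that conv(S) is 2-dimensional, every point of S is a vertex of conv(S), and conv(S) ∩ ℤ² = S, then |S| ≤ 4. Consequently, for a unimodular triangle P ⊆ ℝ² and every i > 4, the number α_i(P;n) of free polytopes with i vertices contained in nP is 0 for all n ≥ 0. -/
open Pointwise

/-- The coercion of an integer vector to a real vector. -/
def ic {d : ℕ} (a : Fin d → ℤ) : Fin d → ℝ := fun i => (a i : ℝ)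

/-- `P ⊆ ℝ²` is a unimodular triangle: the convex hull of lattice points
`v₀, v₁, v₂` with `|det(v₁ - v₀, v₂ - v₀)| = 1`. -/
def UnimodularTriangle (P : Set (Fin 2 → ℝ)) : Prop :=
  ∃ v0 v1 v2 : Fin 2 → ℤ,
    P = convexHull ℝ {ic v0, ic v1, ic v2} ∧
    ((v1 0 - v0 0) * (v2 1 - v0 1) - (v1 1 - v0 1) * (v2 0 - v0 0)).natAbs = 1

/-- `α_i(P;n)`: the number of free lattice polytopes with exactly `i` vertices
contained in `nP`, counted by their vertex sets `s`: every point of `s` is a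
vertex (extreme point) of `conv(s)` and `conv(s) ∩ ℤ² = s`. -/
noncomputable def alphaI (P : Set (Fin 2 → ℝ)) (i n : ℕ) : ℕ :=
  Set.ncard {s : Finset (Fin 2 → ℤ) | s.card = i ∧
    (∀ a ∈ s, ic a ∈ Set.extremePoints ℝ (convexHull ℝ (ic '' ↑s))) ∧
    convexHull ℝ (ic '' ↑s) ⊆ (n : ℝ) • P ∧
    {x : Fin 2 → ℤ | ic x ∈ convexHull ℝ (ic '' ↑s)} = ↑s}

theorem free_card_le_four (S : Finset (Fin 2 → ℤ))
    (hext : ∀ a ∈ S, ic a ∈ Set.extremePoints ℝ (convexHull ℝ (ic '' (S : Set (Fin 2 → ℤ)))))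
    (hfree : {x : Fin 2 → ℤ | ic x ∈ convexHull ℝ (ic '' (S : Set (Fin 2 → ℤ)))} =
      (S : Set (Fin 2 → ℤ))) : S.card ≤ 4 := by
  by_contra! hlt
  -- pigeonhole on parities
  obtain ⟨a, ha, b, hb, hab, hpar⟩ :=
    Finset.exists_ne_map_eq_of_card_lt_of_maps_to
      (s := S) (t := (Finset.univ : Finset (ZMod 2 × ZMod 2)))
      (f := fun x => ((x 0 : ZMod 2), (x 1 : ZMod 2)))
      (by simpa [ZMod.card] using hlt) (fun _ _ => by simp)
  simp only [Prod.mk.injEq, ZMod.intCast_eq_intCast_iff] at hpar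
  obtain ⟨h0, h1⟩ := hpar
  have hmid : ∀ i, ∃ m : ℤ, 2 * m = a i + b i := by
    intro i
    have h : a i ≡ b i [ZMOD 2] := by
      fin_cases i
      · exact h0
      · exact h1
    refine ⟨(a i + b i) / 2, ?_⟩
    unfold Int.ModEq at h
    omega
  choose m hm using hmid
  have hseg : ic m ∈ openSegment ℝ (ic a) (ic b) := by
    refine ⟨1 / 2, 1 / 2, by norm_num, by norm_num, by norm_num, ?_⟩
    ext i
    have h : (2 : ℝ) * (m i : ℝ) = a i + b i := by exact_mod_cast hm i
    simp only [ic, Pi.add_apply, Pi.smul_apply, smul_eq_mul]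
    linarith
  have hac : ic a ∈ convexHull ℝ (ic '' (S : Set (Fin 2 → ℤ))) := (hext a ha).1
  have hbc : ic b ∈ convexHull ℝ (ic '' (S : Set (Fin 2 → ℤ))) := (hext b hb).1
  have hmc : ic m ∈ convexHull ℝ (ic '' (S : Set (Fin 2 → ℤ))) :=
    (convex_convexHull ℝ _).openSegment_subset hac hbc hseg
  have hmS : m ∈ S := by
    have h : m ∈ (S : Set (Fin 2 → ℤ)) := hfree ▸ hmc
    exact h
  have key := (mem_extremePoints.1 (hext m hmS)).2 _ hac _ hbc hseg
  apply hab
  ext i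
  have h := congrFun (key.1.trans key.2.symm) i
  simpa [ic] using h

theorem free_polygons_at_most_four_vertices :
    (∀ S : Finset (Fin 2 → ℤ),
      Module.finrank ℝ (affineSpan ℝ (convexHull ℝ (ic '' (S : Set (Fin 2 → ℤ))))).direction = 2 →
      (∀ a ∈ S, ic a ∈ Set.extremePoints ℝ (convexHull ℝ (ic '' (S : Set (Fin 2 → ℤ))))) →
      {x : Fin 2 → ℤ | ic x ∈ convexHull ℝ (ic '' (S : Set (Fin 2 → ℤ)))} = (S : Set (Fin 2 → ℤ)) →
      S.card ≤ 4) ∧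
    ∀ P : Set (Fin 2 → ℝ), UnimodularTriangle P →
      ∀ i : ℕ, 4 < i → ∀ n : ℕ, alphaI P i n = 0 := by
  refine ⟨fun S _ hext hfree => free_card_le_four S hext hfree, ?_⟩
  intro P _ i hi n
  unfold alphaI
  rw [Set.eq_empty_of_forall_notMem (s := {s : Finset (Fin 2 → ℤ) | _}), Set.ncard_empty]
  rintro s ⟨hcard, hext, -, hfree⟩
  have := free_card_le_four s hext hfree
  omega
end

section
/- Let b ∈ ℤ^{d+1} with b_1 + ⋯ + b_{d+1} = 0 and gcd(b_1,…,b_{d+1}) = 1, and let n ≥ 1. Write b = b⁺ − b⁻ with b⁺, b⁻ ∈ ℤ^{d+1}_{≥0} having disjoint supports, and set ℓ(b) = Σ_i b⁺_i. Then nΔ_d ∩ (nΔ_d − b) = ∅ if and only if ℓ(b) > n, and if ℓ(b) ≤ n then nΔ_d ∩ (nΔ_d − b) = b⁻ + (n − ℓ(b))Δ_d. -/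
open Pointwise

theorem mem_smul_simplex {d : ℕ} (c : ℝ) (hc : 0 ≤ c) (x : Fin (d + 1) → ℝ) :
    x ∈ c • stdSimplex ℝ (Fin (d + 1)) ↔ (∀ i, 0 ≤ x i) ∧ ∑ i, x i = c := by
  constructor
  · rintro ⟨y, ⟨hy0, hy1⟩, rfl⟩
    refine ⟨fun i => mul_nonneg hc (hy0 i), ?_⟩
    simp [← Finset.mul_sum, hy1]
  · rintro ⟨h0, h1⟩
    rcases hc.eq_or_lt with h | h
    · refine ⟨Pi.single 0 1, single_mem_stdSimplex ℝ 0, ?_⟩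
      subst h
      have := (Finset.sum_eq_zero_iff_of_nonneg (fun i _ => h0 i)).1 h1
      ext i
      simp [this i (Finset.mem_univ i)]
    · refine ⟨c⁻¹ • x, ⟨fun i => mul_nonneg (inv_nonneg.2 hc) (h0 i), ?_⟩, ?_⟩
      · simp [← Finset.mul_sum, h1, h.ne']
      · simp [smul_smul, h.ne']

theorem mem_inter_simplex {d : ℕ} (b : Fin (d + 1) → ℤ) (hsum : ∑ i, b i = 0) (n : ℕ)
    (x : Fin (d + 1) → ℝ) :
    x ∈ ((n : ℝ) • stdSimplex ℝ (Fin (d + 1))) ∩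
        ((fun y => y - ic b) '' ((n : ℝ) • stdSimplex ℝ (Fin (d + 1)))) ↔
      (∀ i, ((max (-b i) 0 : ℤ) : ℝ) ≤ x i) ∧ ∑ i, x i = n := by
  have hs : ∑ i, (b i : ℝ) = 0 := by exact_mod_cast hsum
  have hn : (0 : ℝ) ≤ n := Nat.cast_nonneg n
  constructor
  · rintro ⟨h1, y, hy, rfl⟩
    rw [mem_smul_simplex _ hn] at h1 hy
    refine ⟨fun i => ?_, h1.2⟩
    have a1 := h1.1 i
    have a2 := hy.1 i
    simp only [Pi.sub_apply, ic] at a1 ⊢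
    push_cast
    exact max_le (by linarith) a1
  · rintro ⟨h1, h2⟩
    have h3 : ∀ i, -(b i : ℝ) ≤ x i ∧ 0 ≤ x i := fun i => by
      have := h1 i
      push_cast at this
      exact max_le_iff.1 this
    refine ⟨(mem_smul_simplex _ hn x).2 ⟨fun i => (h3 i).2, h2⟩, x + ic b,
      (mem_smul_simplex _ hn _).2 ⟨fun i => ?_, ?_⟩, by simp⟩
    · have := (h3 i).1
      simp only [Pi.add_apply, ic]
      linarith
    · simp [ic, Finset.sum_add_distrib, h2, hs]

theorem simplex_intersection (d : ℕ) (b : Fin (d + 1) → ℤ)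
    (hsum : ∑ i, b i = 0) (hgcd : Finset.univ.gcd b = 1)
    (n : ℕ) (hn : 1 ≤ n)
    (L : ℕ) (hL : (L : ℤ) = ∑ i, max (b i) 0) :
    (((n : ℝ) • stdSimplex ℝ (Fin (d + 1))) ∩
        ((fun y => y - ic b) '' ((n : ℝ) • stdSimplex ℝ (Fin (d + 1)))) = ∅ ↔ n < L) ∧
    (L ≤ n →
      ((n : ℝ) • stdSimplex ℝ (Fin (d + 1))) ∩
          ((fun y => y - ic b) '' ((n : ℝ) • stdSimplex ℝ (Fin (d + 1))))
        = (fun y => ic (fun i => max (-b i) 0) + y) ''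
            (((n - L : ℕ) : ℝ) • stdSimplex ℝ (Fin (d + 1)))) := by
  have hneg : ∑ i, ((max (-b i) 0 : ℤ) : ℝ) = L := by
    have : ∑ i, max (-b i) 0 = (L : ℤ) := by
      rw [hL, ← sub_eq_zero, ← Finset.sum_sub_distrib, ← neg_eq_zero, ← Finset.sum_neg_distrib,
        ← hsum]
      refine Finset.sum_congr rfl fun i _ => ?_
      omega
    exact_mod_cast this
  have key : L ≤ n →
      ((n : ℝ) • stdSimplex ℝ (Fin (d + 1))) ∩
          ((fun y => y - ic b) '' ((n : ℝ) • stdSimplex ℝ (Fin (d + 1))))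
        = (fun y => ic (fun i => max (-b i) 0) + y) ''
            (((n - L : ℕ) : ℝ) • stdSimplex ℝ (Fin (d + 1))) := by
    intro hle
    ext x
    rw [mem_inter_simplex b hsum]
    constructor
    · rintro ⟨h1, h2⟩
      refine ⟨x - ic (fun i => max (-b i) 0),
        (mem_smul_simplex _ (Nat.cast_nonneg _) _).2 ⟨fun i => sub_nonneg.2 (h1 i), ?_⟩, by simp⟩
      simp only [Pi.sub_apply, ic, Finset.sum_sub_distrib, h2, hneg, Nat.cast_sub hle]
    · rintro ⟨y, hy, rfl⟩
      rw [mem_smul_simplex _ (Nat.cast_nonneg _)] at hy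
      refine ⟨fun i => le_add_of_nonneg_right (hy.1 i), ?_⟩
      simp only [Pi.add_apply, ic, Finset.sum_add_distrib, hy.2, hneg, Nat.cast_sub hle]
      ring
  refine ⟨⟨fun h => ?_, fun h => ?_⟩, key⟩
  · by_contra hlt
    have hle := not_lt.1 hlt
    rw [key hle, Set.image_eq_empty] at h
    have : ((n - L : ℕ) : ℝ) • (Pi.single 0 1 : Fin (d + 1) → ℝ) ∈
        ((n - L : ℕ) : ℝ) • stdSimplex ℝ (Fin (d + 1)) :=
      Set.smul_mem_smul_set (single_mem_stdSimplex ℝ 0)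
    rw [h] at this
    exact this
  · rw [Set.eq_empty_iff_forall_notMem]
    intro x hx
    rw [mem_inter_simplex b hsum] at hx
    have h1 := Finset.sum_le_sum (fun i (_ : i ∈ Finset.univ) => hx.1 i)
    rw [hneg, hx.2] at h1
    exact absurd h (not_lt.2 (by exact_mod_cast h1))
end

section
/- Let b ∈ ℤ^{d+1} with b_1 + ⋯ + b_{d+1} = 0 and gcd(b_1,…,b_{d+1}) = 1, and let n ≥ 1. Set ℓ(b) = Σ_i max(b_i,0). Then the number of lattice translates of the segment [0,b] contained in nΔ_d, namely E_b(n) = |{t ∈ ℤ^{d+1} : t ∈ nΔ_d and t + b ∈ nΔ_d}|, equals C(n − ℓ(b) + d, d) if ℓ(b) ≤ n, and equals 0 if ℓ(b) > n. -/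
open Pointwise

theorem ic_mem_iff {d : ℕ} (n : ℕ) (hn : 1 ≤ n) (t : Fin (d + 1) → ℤ) :
    ic t ∈ (n : ℝ) • stdSimplex ℝ (Fin (d + 1)) ↔ (∀ i, 0 ≤ t i) ∧ ∑ i, t i = n := by
  have hn0 : (n : ℝ) ≠ 0 := by positivity
  have hnp : (0 : ℝ) < n := by positivity
  rw [Set.mem_smul_set_iff_inv_smul_mem₀ hn0]
  simp only [stdSimplex, Set.mem_ofPred_eq, Pi.smul_apply, smul_eq_mul, ic, ← Finset.mul_sum]
  refine and_congr (forall_congr' fun i => ?_) ?_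
  · rw [mul_nonneg_iff_of_pos_left (inv_pos.mpr hnp)]
    exact_mod_cast Iff.rfl
  · rw [inv_mul_eq_one₀ hn0, eq_comm]
    exact_mod_cast Iff.rfl

theorem translates_eq {d : ℕ} (b : Fin (d + 1) → ℤ) (hsum : ∑ i, b i = 0)
    (n : ℕ) (hn : 1 ≤ n) :
    {t : Fin (d + 1) → ℤ |
          ic t ∈ (n : ℝ) • stdSimplex ℝ (Fin (d + 1)) ∧
          ic (t + b) ∈ (n : ℝ) • stdSimplex ℝ (Fin (d + 1))} =
    {t : Fin (d + 1) → ℤ | (∀ i, max (b i) 0 - b i ≤ t i) ∧ ∑ i, t i = (n : ℤ)} := by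
  ext t
  simp only [Set.mem_ofPred_eq, ic_mem_iff n hn, Pi.add_apply, Finset.sum_add_distrib, hsum,
    add_zero]
  constructor
  · rintro ⟨⟨h1, h2⟩, h3, -⟩
    refine ⟨fun i => ?_, h2⟩
    have := h1 i
    have := h3 i
    omega
  · rintro ⟨h1, h2⟩
    refine ⟨⟨fun i => ?_, h2⟩, fun i => ?_, h2⟩ <;>
    · have := h1 i
      omega

theorem count_segment_translates (d : ℕ) (b : Fin (d + 1) → ℤ)
    (hsum : ∑ i, b i = 0) (hgcd : Finset.univ.gcd b = 1)
    (n : ℕ) (hn : 1 ≤ n)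
    (L : ℕ) (hL : (L : ℤ) = ∑ i, max (b i) 0) :
    (L ≤ n →
      Set.ncard {t : Fin (d + 1) → ℤ |
          ic t ∈ (n : ℝ) • stdSimplex ℝ (Fin (d + 1)) ∧
          ic (t + b) ∈ (n : ℝ) • stdSimplex ℝ (Fin (d + 1))}
        = Nat.choose (n - L + d) d) ∧
    (n < L →
      Set.ncard {t : Fin (d + 1) → ℤ |
          ic t ∈ (n : ℝ) • stdSimplex ℝ (Fin (d + 1)) ∧
          ic (t + b) ∈ (n : ℝ) • stdSimplex ℝ (Fin (d + 1))}
        = 0) := by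
  rw [translates_eq b hsum n hn]
  have hc : ∑ i, (max (b i) 0 - b i) = (L : ℤ) := by
    rw [Finset.sum_sub_distrib, hsum, hL, sub_zero]
  constructor
  · intro hLn
    have hcard : (Finset.finsuppAntidiag (Finset.univ : Finset (Fin (d + 1))) (n - L)).card
        = Nat.choose (n - L + d) d := by
      rw [Finset.card_finsuppAntidiag_nat_eq_choose]
      simp only [Finset.card_univ, Fintype.card_fin]
      rw [← Nat.choose_symm_add]
      congr 1
      omega
    rw [← hcard, ← Set.ncard_coe_finset]
    symm
    refine Set.ncard_congr (fun s _ i => (s i : ℤ) + (max (b i) 0 - b i)) ?_ ?_ ?_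
    · intro s hs
      simp only [Finset.mem_coe, Finset.mem_finsuppAntidiag] at hs
      refine ⟨fun i => by simp, ?_⟩
      have h := congrArg (Nat.cast : ℕ → ℤ) hs.1
      push_cast [hLn] at h
      rw [Finset.sum_add_distrib, hc, h]
      ring
    · intro s s' _ _ h
      ext i
      have := congrFun h i
      omega
    · rintro t ⟨h1, h2⟩
      refine ⟨Finsupp.equivFunOnFinite.symm
        (fun i => (t i - (max (b i) 0 - b i)).toNat), ?_, ?_⟩
      · simp only [Finset.mem_coe, Finset.mem_finsuppAntidiag]
        refine ⟨?_, Finset.subset_univ _⟩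
        zify [hLn]
        rw [← h2, ← hc, ← Finset.sum_sub_distrib]
        refine Finset.sum_congr rfl fun i _ => ?_
        have := h1 i
        simp only [Finsupp.equivFunOnFinite_symm_apply_apply]
        omega
      · funext i
        have := h1 i
        simp only [Finsupp.equivFunOnFinite_symm_apply_apply]
        omega
  · intro hnL
    convert Set.ncard_empty (Fin (d + 1) → ℤ) using 2
    rw [Set.eq_empty_iff_forall_notMem]
    rintro t ⟨h1, h2⟩
    have := Finset.sum_le_sum fun i (_ : i ∈ Finset.univ) => h1 i
    rw [hc, h2] at this
    omega
end

section
/- For all integers d ≥ 1 and ℓ ≥ 1, the number of vectors b ∈ ℤ^{d+1} with b_1 + ⋯ + b_{d+1} = 0, gcd(b_1,…,b_{d+1}) = 1 and ℓ(b) = ℓ equals CE(∂∇_d; ℓ) = |{b ∈ ℤ^{d+1} : b ∈ ℓ·∂∇_d and gcd(b_1,…,b_{d+1},ℓ) = 1}|, where ℓ(b) = Σ_i max(b_i,0). -/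
open Pointwise

/-- The coprime Ehrhart function, applicable to any set `S ⊆ ℝ^d`:
`CE(S;n) = |{a ∈ nS ∩ ℤ^d : gcd(a_1,…,a_d,n) = 1}|`. -/
noncomputable def CE {d : ℕ} (S : Set (Fin d → ℝ)) (n : ℕ) : ℕ :=
  Set.ncard {a : Fin d → ℤ | ic a ∈ (n : ℝ) • S ∧
    Int.gcd (Finset.univ.gcd a) (n : ℤ) = 1}


/-- The sum of the positive parts. -/
def posSum {n : ℕ} (x : Fin n → ℝ) : ℝ := ∑ i, max (x i) 0

theorem posSum_continuous {n : ℕ} : Continuous (posSum (n := n)) := by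
  unfold posSum
  fun_prop

theorem posSum_smul {n : ℕ} (t : ℝ) (ht : 0 ≤ t) (x : Fin n → ℝ) :
    posSum (t • x) = t * posSum x := by
  unfold posSum
  rw [Finset.mul_sum]
  refine Finset.sum_congr rfl fun i _ => ?_
  rw [mul_max_of_nonneg _ _ ht]
  simp

theorem diff_body_eq (d : ℕ) :
    (stdSimplex ℝ (Fin (d + 1)) + -stdSimplex ℝ (Fin (d + 1)))
      = {x | ∑ i, x i = 0 ∧ posSum x ≤ 1} := by
  ext x
  simp only [Set.mem_add, Set.mem_neg, Set.mem_ofPred_eq]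
  constructor
  · rintro ⟨u, ⟨hu0, hu1⟩, v, ⟨hv0, hv1⟩, rfl⟩
    simp only [Pi.neg_apply, Finset.sum_neg_distrib] at hv0 hv1
    constructor
    · simp only [Pi.add_apply, Finset.sum_add_distrib]
      linarith
    · rw [← hu1]
      unfold posSum
      refine Finset.sum_le_sum fun i _ => ?_
      have := hu0 i
      have := hv0 i
      simp only [Pi.add_apply]
      exact max_le (by linarith) (by linarith)
  · rintro ⟨h0, h1⟩
    have hc : ∀ i : Fin (d+1), 0 ≤ (Pi.single 0 (1 - posSum x) : Fin (d+1) → ℝ) i := by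
      intro i
      have h : (0 : Fin (d+1) → ℝ) ≤ Pi.single 0 (1 - posSum x) := by
        rw [Pi.single_nonneg]; linarith
      exact h i
    have hs : ∑ i, (Pi.single 0 (1 - posSum x) : Fin (d+1) → ℝ) i = 1 - posSum x := by
      simp
    refine ⟨fun i => max (x i) 0 + (Pi.single 0 (1 - posSum x) : Fin (d+1) → ℝ) i, ⟨?_, ?_⟩,
      fun i => x i - max (x i) 0 - (Pi.single 0 (1 - posSum x) : Fin (d+1) → ℝ) i, ⟨?_, ?_⟩, ?_⟩
    · intro i
      exact add_nonneg (le_max_right _ _) (hc i)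
    · rw [Finset.sum_add_distrib, hs]
      unfold posSum
      ring
    · intro i
      have := hc i
      have := le_max_left (x i) 0
      simp only [Pi.neg_apply]
      linarith
    · simp only [Pi.neg_apply, Finset.sum_neg_distrib]
      rw [Finset.sum_sub_distrib, Finset.sum_sub_distrib, hs, h0]
      unfold posSum
      ring
    · ext i
      simp

theorem sum_eq_zero_of_mem_span {n : ℕ} (x : Fin n → ℝ)
    (hx : x ∈ affineSpan ℝ {x : Fin n → ℝ | ∑ i, x i = 0 ∧ posSum x ≤ 1}) :
    ∑ i, x i = 0 := by
  let L : (Fin n → ℝ) →ₗ[ℝ] ℝ := ∑ i, LinearMap.proj i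
  have hL : ∀ y, L y = ∑ i, y i := fun y => by simp [L]
  have : affineSpan ℝ {x : Fin n → ℝ | ∑ i, x i = 0 ∧ posSum x ≤ 1}
      ≤ (LinearMap.ker L).toAffineSubspace := by
    rw [affineSpan_le]
    intro y hy
    change L y = 0
    rw [hL]; exact hy.1
  have h := this hx
  change L x = 0 at h
  rwa [hL] at h

theorem frontier_eq (n : ℕ) :
    intrinsicFrontier ℝ {x : Fin n → ℝ | ∑ i, x i = 0 ∧ posSum x ≤ 1}
      = {x | ∑ i, x i = 0 ∧ posSum x = 1} := by
  set S := {x : Fin n → ℝ | ∑ i, x i = 0 ∧ posSum x ≤ 1} with hS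
  have hclosed : IsClosed S :=
    (isClosed_eq (by fun_prop) continuous_const).inter
      (isClosed_le posSum_continuous continuous_const)
  have h0 : (0 : Fin n → ℝ) ∈ S := by simp [hS, posSum]
  rw [← intrinsicClosure_sdiff_intrinsicInterior,
    IsClosed.intrinsicClosure (hclosed.preimage continuous_subtype_val)]
  ext x
  constructor
  · rintro ⟨⟨hx0, hx1⟩, hx⟩
    refine ⟨hx0, le_antisymm hx1 (not_lt.1 fun hlt => hx ?_)⟩
    rw [mem_intrinsicInterior]
    refine ⟨⟨x, subset_affineSpan ℝ S ⟨hx0, hx1⟩⟩, ?_, rfl⟩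
    rw [mem_interior]
    refine ⟨{y | posSum (y : Fin n → ℝ) < 1}, ?_, ?_, hlt⟩
    · intro y hy
      exact ⟨sum_eq_zero_of_mem_span _ y.2, le_of_lt hy⟩
    · exact isOpen_lt (posSum_continuous.comp continuous_subtype_val) continuous_const
  · rintro ⟨hx0, hx1⟩
    refine ⟨⟨hx0, hx1.le⟩, fun hx => ?_⟩
    rw [mem_intrinsicInterior] at hx
    obtain ⟨y, hy, rfl⟩ := hx
    have hmem : ∀ t : ℝ, t • (y : Fin n → ℝ) ∈ affineSpan ℝ S := by
      intro t
      have := AffineMap.lineMap_mem t (subset_affineSpan ℝ S h0) y.2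
      simpa [AffineMap.lineMap_apply] using this
    let g : ℝ → affineSpan ℝ S := fun t => ⟨t • (y : Fin n → ℝ), hmem t⟩
    have hg : Continuous g := by
      refine Continuous.subtype_mk ?_ _
      fun_prop
    have hg1 : g 1 = y := by ext; simp [g]
    have hnhds : g ⁻¹' ((↑) ⁻¹' S) ∈ nhds (1 : ℝ) := by
      refine hg.continuousAt ?_
      rw [hg1]
      exact mem_interior_iff_mem_nhds.1 hy
    obtain ⟨ε, hε, hb⟩ := Metric.mem_nhds_iff.1 hnhds
    have h2 : (1 + ε / 2) ∈ Metric.ball (1 : ℝ) ε := by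
      rw [Metric.mem_ball, Real.dist_eq, add_sub_cancel_left, abs_of_pos (by linarith)]
      linarith
    have h3 : posSum ((1 + ε / 2) • (y : Fin n → ℝ)) ≤ 1 := (hb h2).2
    rw [posSum_smul _ (by linarith), hx1] at h3
    linarith

theorem primitive_count_eq_CE_boundary (d ℓ : ℕ) (hd : 1 ≤ d) (hℓ : 1 ≤ ℓ) :
    Set.ncard {b : Fin (d + 1) → ℤ | ∑ i, b i = 0 ∧ Finset.univ.gcd b = 1 ∧
        ∑ i, max (b i) 0 = (ℓ : ℤ)}
      = CE (intrinsicFrontier ℝ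
          (stdSimplex ℝ (Fin (d + 1)) + -stdSimplex ℝ (Fin (d + 1)))) ℓ := by
  rw [diff_body_eq, frontier_eq]
  unfold CE
  congr 1
  ext b
  have hpos : (0 : ℝ) < ℓ := by exact_mod_cast hℓ
  have key : ic b ∈ (ℓ : ℝ) • {x : Fin (d+1) → ℝ | ∑ i, x i = 0 ∧ posSum x = 1} ↔
      ∑ i, b i = 0 ∧ ∑ i, max (b i) 0 = (ℓ : ℤ) := by
    rw [Set.mem_smul_set_iff_inv_smul_mem₀ hpos.ne']
    simp only [Set.mem_ofPred_eq, posSum_smul _ (inv_nonneg.2 hpos.le), Pi.smul_apply,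
      smul_eq_mul, ← Finset.mul_sum]
    have e1 : ∑ i, ic b i = ((∑ i, b i : ℤ) : ℝ) := by simp [ic]
    have e2 : posSum (ic b) = ((∑ i, max (b i) 0 : ℤ) : ℝ) := by simp [ic, posSum]
    rw [e1, e2, inv_mul_eq_one₀ hpos.ne', mul_eq_zero_iff_left (inv_ne_zero hpos.ne')]
    constructor
    · rintro ⟨h1, h2⟩
      exact ⟨by exact_mod_cast h1, by exact_mod_cast h2.symm⟩
    · rintro ⟨h1, h2⟩
      exact ⟨by exact_mod_cast h1, by rw [h2]; simp⟩
  rw [Set.mem_ofPred_eq, Set.mem_ofPred_eq, key]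
  constructor
  · rintro ⟨h1, h2, h3⟩
    exact ⟨⟨h1, h3⟩, by rw [h2]; simp⟩
  · rintro ⟨⟨h1, h3⟩, h2⟩
    refine ⟨h1, ?_, h3⟩
    have hdvd : Finset.univ.gcd b ∣ (ℓ : ℤ) := by
      rw [← h3]
      refine Finset.dvd_sum fun i _ => ?_
      rcases max_choice (b i) 0 with h | h <;> rw [h]
      · exact Finset.gcd_dvd (Finset.mem_univ i)
      · exact dvd_zero _
    have h4 : (Finset.univ.gcd b).natAbs = 1 := by
      exact (Nat.gcd_eq_left (Int.natAbs_dvd_natAbs.2 hdvd)).symm.trans h2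
    have h5 : normalize (Finset.univ.gcd b) = Finset.univ.gcd b := Finset.normalize_gcd
    rw [← h5, ← Int.abs_eq_normalize, Int.abs_eq_natAbs, h4]
    rfl
end
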